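/- arXiv:1208.3262 — 2 statements merged into one kernel-verified Lean document; each statement's English description precedes it below -/
import Mathlib

section
/- Let Ξ = (a₀, a₁) : ℝ³ → ℝ² be the characteristic map of the Gyroid, with a₁(a,b,c) = −2cos a − 2cos b − 2cos c − 2cos(a+b+c) and a₀(a,b,c) = 3 − 2cos(a+b) − 2cos(b+c) − 2cos(a+c). Then the Jacobian matrix of Ξ (i.e., all six partial derivatives ∂a₀/∂a, ∂a₀/∂b, ∂a₀/∂c, ∂a₁/∂a, ∂a₁/∂b, ∂a₁/∂c) vanishes at each of the four points (0,0,0), (π,π,π), (π/2,π/2,π/2), (3π/2,3π/2,3π/2). -/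
open Real

/-- Coefficient `a₁` of the characteristic polynomial of the Gyroid Harper Hamiltonian. -/
noncomputable def gyroidA1 (a b c : ℝ) : ℝ :=
  -2 * Real.cos a - 2 * Real.cos b - 2 * Real.cos c - 2 * Real.cos (a + b + c)

/-- Coefficient `a₀` of the characteristic polynomial of the Gyroid Harper Hamiltonian. -/
noncomputable def gyroidA0 (a b c : ℝ) : ℝ :=
  3 - 2 * Real.cos (a + b) - 2 * Real.cos (b + c) - 2 * Real.cos (a + c)

/-- Partial derivative in the first variable. -/
noncomputable def pda (f : ℝ → ℝ → ℝ → ℝ) (a b c : ℝ) : ℝ :=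
  deriv (fun t => f t b c) a

/-- Partial derivative in the second variable. -/
noncomputable def pdb (f : ℝ → ℝ → ℝ → ℝ) (a b c : ℝ) : ℝ :=
  deriv (fun t => f a t c) b

/-- Partial derivative in the third variable. -/
noncomputable def pdc (f : ℝ → ℝ → ℝ → ℝ) (a b c : ℝ) : ℝ :=
  deriv (fun t => f a b t) c

theorem hasDerivAt_cos_add_const (k x : ℝ) :
    HasDerivAt (fun t => Real.cos (t + k)) (-Real.sin (x + k)) x := by
  simpa using ((hasDerivAt_id x).add_const k).cos

theorem pda_gyroidA0 (a b c : ℝ) :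
    pda gyroidA0 a b c = 2 * Real.sin (a + b) + 2 * Real.sin (a + c) := by
  have h := (((hasDerivAt_cos_add_const b a).const_mul (-2)).add
    ((hasDerivAt_cos_add_const c a).const_mul (-2))).add_const (3 - 2 * Real.cos (b + c))
  refine Eq.trans (congrArg (fun f => deriv f a) (funext fun t => ?_)) (h.deriv.trans (by ring))
  simp only [gyroidA0, Pi.add_apply]
  ring

theorem pda_gyroidA1 (a b c : ℝ) :
    pda gyroidA1 a b c = 2 * Real.sin a + 2 * Real.sin (a + b + c) := by
  have h := (((Real.hasDerivAt_cos a).const_mul (-2)).add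
    ((hasDerivAt_cos_add_const (b + c) a).const_mul (-2))).add_const
      (-2 * Real.cos b - 2 * Real.cos c)
  refine Eq.trans (congrArg (fun f => deriv f a) (funext fun t => ?_))
    (h.deriv.trans (by rw [add_assoc]; ring))
  simp only [gyroidA1, Pi.add_apply, add_assoc]
  ring

theorem gyroidA0_swap_left (a b c : ℝ) : gyroidA0 a b c = gyroidA0 b a c := by
  simp only [gyroidA0, add_comm b a]
  ring

theorem gyroidA0_swap_outer (a b c : ℝ) : gyroidA0 a b c = gyroidA0 c b a := by
  simp only [gyroidA0, add_comm c b, add_comm b a, add_comm c a]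
  ring

theorem gyroidA1_swap_left (a b c : ℝ) : gyroidA1 a b c = gyroidA1 b a c := by
  simp only [gyroidA1, add_comm b a]
  ring

theorem gyroidA1_swap_outer (a b c : ℝ) : gyroidA1 a b c = gyroidA1 c b a := by
  simp only [gyroidA1, show c + b + a = a + b + c by ring]
  ring

theorem pdb_eq_pda_of_swap {f : ℝ → ℝ → ℝ → ℝ} (hf : ∀ a b c, f a b c = f b a c) (a b c : ℝ) :
    pdb f a b c = pda f b a c :=
  congrArg (fun g => deriv g b) (funext fun t => hf a t c)

theorem pdc_eq_pda_of_swap {f : ℝ → ℝ → ℝ → ℝ} (hf : ∀ a b c, f a b c = f c b a) (a b c : ℝ) :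
    pdc f a b c = pda f c b a :=
  congrArg (fun g => deriv g c) (funext fun t => hf a b t)

/-- At a diagonal point the Jacobian vanishes as soon as `sin (2x) = 0`, because
`sin (3x) + sin x = 2 sin (2x) cos x`. -/
theorem gyroid_jacobian_diagonal {x : ℝ} (hx : Real.sin (x + x) = 0) :
    pda gyroidA0 x x x = 0 ∧ pdb gyroidA0 x x x = 0 ∧ pdc gyroidA0 x x x = 0 ∧
      pda gyroidA1 x x x = 0 ∧ pdb gyroidA1 x x x = 0 ∧ pdc gyroidA1 x x x = 0 := by
  have h0 : pda gyroidA0 x x x = 0 := by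
    rw [pda_gyroidA0, hx]
    ring
  have h1 : pda gyroidA1 x x x = 0 := by
    have h : Real.sin (x + x + x) + Real.sin (x + x - x) = 0 := by
      rw [Real.sin_add, Real.sin_sub, hx]
      ring
    rw [add_sub_cancel_right] at h
    rw [pda_gyroidA1]
    linarith
  exact ⟨h0, (pdb_eq_pda_of_swap gyroidA0_swap_left x x x).trans h0,
    (pdc_eq_pda_of_swap gyroidA0_swap_outer x x x).trans h0, h1,
    (pdb_eq_pda_of_swap gyroidA1_swap_left x x x).trans h1,
    (pdc_eq_pda_of_swap gyroidA1_swap_outer x x x).trans h1⟩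

theorem gyroid_jacobian_vanishes :
    ∀ p : ℝ × ℝ × ℝ,
      p ∈ ({((0 : ℝ), (0 : ℝ), (0 : ℝ)), (π, π, π), (π / 2, π / 2, π / 2),
            (3 * π / 2, 3 * π / 2, 3 * π / 2)} : Set (ℝ × ℝ × ℝ)) →
      pda gyroidA0 p.1 p.2.1 p.2.2 = 0 ∧ pdb gyroidA0 p.1 p.2.1 p.2.2 = 0 ∧
      pdc gyroidA0 p.1 p.2.1 p.2.2 = 0 ∧ pda gyroidA1 p.1 p.2.1 p.2.2 = 0 ∧
      pdb gyroidA1 p.1 p.2.1 p.2.2 = 0 ∧ pdc gyroidA1 p.1 p.2.1 p.2.2 = 0 := by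
  rintro p (rfl | rfl | rfl | rfl)
  · exact gyroid_jacobian_diagonal (by simp)
  · exact gyroid_jacobian_diagonal (by rw [← two_mul, Real.sin_two_pi])
  · exact gyroid_jacobian_diagonal (by rw [add_halves, Real.sin_pi])
  · refine gyroid_jacobian_diagonal ?_
    rw [add_halves]
    exact_mod_cast Real.sin_nat_mul_pi 3
end

section
/- Let P(u,v,z) = z² − 3 − 2cos u − 2cos v − 2cos(u−v) as a smooth real function on ℝ³. Then the set of points (u,v,z) with u,v ∈ [0,2π) satisfying simultaneously P = 0, ∂P/∂u = 0, ∂P/∂v = 0 and ∂P/∂z = 0 is exactly the two points {(2π/3, 4π/3, 0), (4π/3, 2π/3, 0)}. -/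
open Real

/-- The characteristic polynomial of the honeycomb (graphene) Harper Hamiltonian,
as a smooth real function of `(u, v, z)`. -/
noncomputable def P (u v z : ℝ) : ℝ :=
  z ^ 2 - 3 - 2 * Real.cos u - 2 * Real.cos v - 2 * Real.cos (u - v)

/-- Partial derivative in the first variable. -/
noncomputable def pdu (f : ℝ → ℝ → ℝ → ℝ) (u v z : ℝ) : ℝ :=
  deriv (fun t => f t v z) u

/-- Partial derivative in the second variable. -/
noncomputable def pdv (f : ℝ → ℝ → ℝ → ℝ) (u v z : ℝ) : ℝ :=
  deriv (fun t => f u t z) v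

/-- Partial derivative in the third variable. -/
noncomputable def pdz (f : ℝ → ℝ → ℝ → ℝ) (u v z : ℝ) : ℝ :=
  deriv (fun t => f u v t) z

lemma cos_two_mul_pi_div_three : Real.cos (2 * π / 3) = -1 / 2 := by
  rw [show 2 * π / 3 = π - π / 3 by ring, Real.cos_pi_sub, Real.cos_pi_div_three]
  norm_num

lemma cos_four_mul_pi_div_three : Real.cos (4 * π / 3) = -1 / 2 := by
  rw [show 4 * π / 3 = 2 * π - 2 * π / 3 by ring, Real.cos_two_pi_sub,
    cos_two_mul_pi_div_three]

lemma sin_four_mul_pi_div_three : Real.sin (4 * π / 3) = -Real.sin (2 * π / 3) := by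
  rw [show 4 * π / 3 = 2 * π - 2 * π / 3 by ring, Real.sin_two_pi_sub]

lemma eq_of_cos_eq_neg_half {u : ℝ} (hu : u ∈ Set.Ico 0 (2 * π))
    (h : Real.cos u = -1 / 2) : u = 2 * π / 3 ∨ u = 4 * π / 3 := by
  have hπ := Real.pi_pos
  have hmem : 2 * π / 3 ∈ Set.Icc 0 π := ⟨by positivity, by linarith⟩
  rcases le_total u π with hle | hle
  · left
    exact Real.injOn_cos ⟨hu.1, hle⟩ hmem (by rw [h, cos_two_mul_pi_div_three])
  · right
    have : 2 * π - u = 2 * π / 3 :=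
      Real.injOn_cos ⟨by linarith [hu.2], by linarith⟩ hmem
        (by rw [Real.cos_two_pi_sub, h, cos_two_mul_pi_div_three])
    linarith

lemma P_eq (u v z : ℝ) :
    P u v z = z ^ 2 -
      ((1 + Real.cos u + Real.cos v) ^ 2 + (Real.sin u + Real.sin v) ^ 2) := by
  rw [P, Real.cos_sub]
  linear_combination Real.sin_sq_add_cos_sq u + Real.sin_sq_add_cos_sq v

lemma pdu_P (u v z : ℝ) : pdu P u v z = 2 * Real.sin u + 2 * Real.sin (u - v) := by
  have h := ((((Real.hasDerivAt_cos u).const_mul 2).const_sub (z ^ 2 - 3)).sub_const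
    (2 * Real.cos v)).sub ((((hasDerivAt_id u).sub_const v).cos).const_mul 2)
  refine h.deriv.trans ?_
  simp only [id]
  ring

lemma pdv_P (u v z : ℝ) : pdv P u v z = 2 * Real.sin v - 2 * Real.sin (u - v) := by
  have h := (((Real.hasDerivAt_cos v).const_mul 2).const_sub
    (z ^ 2 - 3 - 2 * Real.cos u)).sub ((((hasDerivAt_id v).const_sub u).cos).const_mul 2)
  refine h.deriv.trans ?_
  simp only [id]
  ring

lemma pdz_P (u v z : ℝ) : pdz P u v z = 2 * z := by
  have h := (((((hasDerivAt_id z).pow 2).sub_const 3).sub_const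
    (2 * Real.cos u)).sub_const (2 * Real.cos v)).sub_const (2 * Real.cos (u - v))
  refine h.deriv.trans ?_
  simp

lemma cos_eq_neg_half_of_sum_eq_zero {u v : ℝ} (hc : 1 + Real.cos u + Real.cos v = 0)
    (hs : Real.sin u + Real.sin v = 0) : Real.cos u = -1 / 2 := by
  linear_combination (1 / 2) * (Real.sin u - Real.sin v) * hs
    - (1 / 2) * Real.sin_sq_add_cos_sq u + (1 / 2) * Real.sin_sq_add_cos_sq v
    + (1 / 2 * (Real.cos u - Real.cos v) + 1 / 2) * hc

theorem honeycomb_critical_points :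
    {p : ℝ × ℝ × ℝ |
        p.1 ∈ Set.Ico 0 (2 * π) ∧ p.2.1 ∈ Set.Ico 0 (2 * π) ∧
        P p.1 p.2.1 p.2.2 = 0 ∧
        pdu P p.1 p.2.1 p.2.2 = 0 ∧
        pdv P p.1 p.2.1 p.2.2 = 0 ∧
        pdz P p.1 p.2.1 p.2.2 = 0} =
      {(2 * π / 3, 4 * π / 3, (0 : ℝ)), (4 * π / 3, 2 * π / 3, (0 : ℝ))} := by
  have hπ := Real.pi_pos
  have hsin : 0 < Real.sin (2 * π / 3) :=
    Real.sin_pos_of_pos_of_lt_pi (by positivity) (by linarith)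
  ext ⟨u, v, z⟩
  simp only [Set.mem_ofPred_eq, Set.mem_insert_iff, Set.mem_singleton_iff, Prod.mk.injEq,
    pdu_P, pdv_P, pdz_P, P_eq]
  constructor
  · rintro ⟨hu, hv, hP, -, -, hz⟩
    obtain rfl : z = 0 := by linarith
    have hc : 1 + Real.cos u + Real.cos v = 0 := by
      nlinarith [sq_nonneg (Real.sin u + Real.sin v)]
    have hs : Real.sin u + Real.sin v = 0 := by
      nlinarith [sq_nonneg (1 + Real.cos u + Real.cos v)]
    have hcu := cos_eq_neg_half_of_sum_eq_zero hc hs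
    rcases eq_of_cos_eq_neg_half hu hcu with rfl | rfl <;>
      rcases eq_of_cos_eq_neg_half hv (by linarith) with rfl | rfl
    · linarith
    · simp
    · simp
    · rw [sin_four_mul_pi_div_three] at hs
      linarith
  · have hd : Real.sin (2 * π / 3 - 4 * π / 3) = -Real.sin (2 * π / 3) := by
      rw [← Real.sin_neg]
      ring_nf
    have hd' : Real.sin (4 * π / 3 - 2 * π / 3) = Real.sin (2 * π / 3) := by
      ring_nf
    rintro (⟨rfl, rfl, rfl⟩ | ⟨rfl, rfl, rfl⟩) <;>
      simp only [hd, hd', cos_two_mul_pi_div_three, cos_four_mul_pi_div_three,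
        sin_four_mul_pi_div_three] <;>
      refine ⟨⟨by positivity, by linarith⟩, ⟨by positivity, by linarith⟩, ?_, ?_, ?_, ?_⟩ <;>
      ring
end
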